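/- arXiv:2409.00849 — 3 statements merged into one kernel-verified Lean document; each statement's English description precedes it below -/
import Mathlib

section
/- Assume ABCD ∉ {q^{−l} : l ∈ ℕ₀} and AC ≠ 1. Let (V, 𝐃, 𝐄, w, v) be any DEHP representation with w(v) = 1, and set 𝐀 := 𝐃𝐄 − 𝐄𝐃. Then for every integer N ≥ 1 the quantity Ẑ_N := Σ_{i=1}^{N} w((𝐃+𝐄)^{i−1} 𝐀 (𝐃+𝐄)^{N−i} v), which equals the coefficient of y¹ in the polynomial y ↦ w((𝐄+𝐃+y𝐀)^N v), is nonzero. -/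
open Classical

noncomputable section

/-- The function `φ₊`. -/
def phiP (q x y : ℝ) : ℝ :=
  (1 - q - x + y + Real.sqrt ((1 - q - x + y) ^ 2 + 4 * x * y)) / (2 * x)

/-- The function `φ₋`. -/
def phiM (q x y : ℝ) : ℝ :=
  (1 - q - x + y - Real.sqrt ((1 - q - x + y) ^ 2 + 4 * x * y)) / (2 * x)

/-- Uniqueness of the stationary measure: a signed stationary measure of total mass zero vanishes,
when from every state of its support one can descend along jumps of positive rate to `t`.
The jumps are given by involutions `σ m` with rates `r m`. -/
theorem stationary_eq_zero_of_sum_eq_zero {S M P : Type*} [Fintype S] [Fintype M] [LinearOrder P]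
    (σ : M → S → S) (hσ : ∀ m, Function.Involutive (σ m)) (r : M → S → ℝ) (hr : ∀ m c, 0 ≤ r m c)
    (Φ : S → P) (t : S) (F : S → ℝ)
    (hΦ : ∀ c, F c ≠ 0 → c ≠ t → ∃ m, 0 < r m c ∧ Φ (σ m c) < Φ c)
    (hF : ∀ c, ∑ m, (r m (σ m c) * F (σ m c) - r m c * F c) = 0)
    (hsum : ∑ c, F c = 0) (c : S) : F c = 0 := by
  have habs : ∀ c, ∑ m, (r m (σ m c) * |F (σ m c)| - r m c * |F c|) = 0 := by
    have hnonneg : ∀ c, 0 ≤ ∑ m, (r m (σ m c) * |F (σ m c)| - r m c * |F c|) := by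
      intro c
      have h1 := hF c
      rw [Finset.sum_sub_distrib, sub_eq_zero] at h1
      rw [Finset.sum_sub_distrib, sub_nonneg]
      calc ∑ m, r m c * |F c| = |∑ m, r m c * F c| := by
            rw [← Finset.sum_mul, ← Finset.sum_mul, abs_mul,
              abs_of_nonneg (Finset.sum_nonneg fun m _ => hr m c)]
        _ = |∑ m, r m (σ m c) * F (σ m c)| := by rw [h1]
        _ ≤ ∑ m, |r m (σ m c) * F (σ m c)| := Finset.abs_sum_le_sum_abs _ _
        _ = ∑ m, r m (σ m c) * |F (σ m c)| := by
            simp only [abs_mul, abs_of_nonneg (hr _ _)]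
    have htot : ∑ c, ∑ m, (r m (σ m c) * |F (σ m c)| - r m c * |F c|) = 0 := by
      rw [Finset.sum_comm]
      refine Finset.sum_eq_zero fun m _ => ?_
      rw [Finset.sum_sub_distrib, sub_eq_zero]
      exact Equiv.sum_comp (hσ m).toPerm fun c => r m c * |F c|
    intro c
    exact (Finset.sum_eq_zero_iff_of_nonneg fun c _ => hnonneg c).1 htot c (Finset.mem_univ c)
  have hpos : ∀ G : S → ℝ, (∀ c, 0 ≤ G c) → (∀ c, F c = 0 → G c = 0) →
      (∀ c, ∑ m, (r m (σ m c) * G (σ m c) - r m c * G c) = 0) → (∃ c, G c ≠ 0) → G t ≠ 0 := by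
    intro G hG hsupp hstat ⟨c₀, hc₀⟩
    obtain ⟨c, hc, hmin⟩ := Finset.exists_min_image (Finset.univ.filter fun c => G c ≠ 0) Φ
      ⟨c₀, by simpa using hc₀⟩
    simp only [Finset.mem_filter, Finset.mem_univ, true_and] at hc hmin
    by_contra hGt
    have hct : c ≠ t := fun h => hc (h ▸ hGt)
    obtain ⟨m, hm, hlt⟩ := hΦ c (fun h => hc (hsupp c h)) hct
    refine absurd (hmin (σ m c) fun h0 => ?_) (not_le.2 hlt)
    have h1 := hstat (σ m c)
    simp only [h0, mul_zero, sub_zero] at h1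
    have h2 := (Finset.sum_eq_zero_iff_of_nonneg
      fun m' _ => mul_nonneg (hr m' _) (hG _)).1 h1 m (Finset.mem_univ m)
    rw [hσ m c] at h2
    exact hc ((mul_eq_zero.1 h2).resolve_left hm.ne')
  have hcomb : ∀ s : ℝ, ∀ c, ∑ m, (r m (σ m c) * (|F (σ m c)| + s * F (σ m c))
      - r m c * (|F c| + s * F c)) = 0 := by
    intro s c
    have := congrArg₂ (· + s * ·) (habs c) (hF c)
    simp only [Finset.mul_sum, ← Finset.sum_add_distrib, mul_zero, add_zero] at this
    rw [← this]
    exact Finset.sum_congr rfl fun m _ => by ring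
  have hsign : (∀ c, |F c| + 1 * F c = 0) ∨ ∀ c, |F c| + (-1) * F c = 0 := by
    by_contra! h
    have h1 := hpos _ (fun c => by linarith [neg_abs_le (F c)]) (fun c hc => by simp [hc])
      (hcomb 1) h.1
    have h2 := hpos _ (fun c => by linarith [le_abs_self (F c)]) (fun c hc => by simp [hc])
      (hcomb (-1)) h.2
    rcases abs_choice (F t) with h | h <;> rw [h] at h1 h2
    · exact h2 (by ring)
    · exact h1 (by ring)
  rcases hsign with h | h
  · have hle : ∀ c ∈ Finset.univ, F c ≤ 0 := fun c _ => by linarith [h c, abs_nonneg (F c)]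
    exact (Finset.sum_eq_zero_iff_of_nonpos hle).1 hsum c (Finset.mem_univ c)
  · have hge : ∀ c ∈ Finset.univ, 0 ≤ F c := fun c _ => by linarith [h c, abs_nonneg (F c)]
    exact (Finset.sum_eq_zero_iff_of_nonneg hge).1 hsum c (Finset.mem_univ c)

theorem phiP_eq_of_root {q x y z : ℝ} (hx : 0 < x) (hy : 0 ≤ y) (hz : 0 < z)
    (h : x * z ^ 2 - (1 - q - x + y) * z - y = 0) : phiP q x y = z := by
  have hs : Real.sqrt ((1 - q - x + y) ^ 2 + 4 * x * y) = 2 * x * z - (1 - q - x + y) := by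
    rw [show (1 - q - x + y) ^ 2 + 4 * x * y = (2 * x * z - (1 - q - x + y)) ^ 2 by
      linear_combination (-4 * x) * h]
    refine Real.sqrt_sq (le_of_mul_le_mul_right ?_ hz)
    nlinarith [mul_pos hx (pow_pos hz 2)]
  rw [phiP, hs]
  field_simp
  ring

theorem phiP_mul_phiP_eq_one {q α β γ δ : ℝ} (hα : 0 < α) (hβ : 0 < β) (hγ : 0 ≤ γ) (hδ : 0 ≤ δ)
    (h : (α + β + γ + δ) * (α * β - γ * δ) = (1 - q) * ((α + δ) * (β + γ))) :
    phiP q β δ * phiP q α γ = 1 := by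
  have h1 : 0 < α + δ := by positivity
  have h2 : 0 < β + γ := by positivity
  rw [phiP_eq_of_root hβ hδ (div_pos h1 h2) (by field_simp; linear_combination h),
    phiP_eq_of_root hα hγ (div_pos h2 h1) (by field_simp; linear_combination h)]
  field_simp

/-- Rate at which neighbouring letters `a, b` (hole `0`, second class particle `1`, particle `2`)
are exchanged. -/
def swapRate (q : ℝ) (a b : Fin 3) : ℝ := if b < a then 1 else if a < b then q else 0

/-- The operator associated with a configuration. -/
def wordProd {R : Type*} [Monoid R] (X : Fin 3 → R) {n : ℕ} (c : Fin n → Fin 3) : R :=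
  (List.ofFn fun i => X (c i)).prod

/-- The number of second class particles of a configuration. -/
def secondCount {n : ℕ} (c : Fin n → Fin 3) : ℕ := (List.ofFn c).count 1

/-- Exchange of the letters at a bond. -/
def bondSwap {n : ℕ} (i : Fin n) (c : Fin (n + 1) → Fin 3) : Fin (n + 1) → Fin 3 :=
  c ∘ Equiv.swap i.castSucc i.succ

/-- Exchange of particle and hole at a site. -/
def siteFlip {n : ℕ} (i : Fin n) (c : Fin n → Fin 3) : Fin n → Fin 3 :=
  Function.update c i (c i).rev

theorem wordProd_succ {R : Type*} [Monoid R] (X : Fin 3 → R) {n : ℕ} (c : Fin (n + 1) → Fin 3) :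
    wordProd X c = X (c 0) * wordProd X fun i => c i.succ := by
  simp [wordProd, List.ofFn_succ]

theorem wordProd_succ_last {R : Type*} [Monoid R] (X : Fin 3 → R) {n : ℕ}
    (c : Fin (n + 1) → Fin 3) :
    wordProd X c = (wordProd X fun i => c i.castSucc) * X (c (Fin.last n)) := by
  rw [wordProd, List.ofFn_succ', List.concat_eq_append, List.prod_append, List.prod_singleton,
    wordProd]

theorem secondCount_succ {n : ℕ} (c : Fin (n + 1) → Fin 3) :
    secondCount c = secondCount (fun i => c i.succ) + if c 0 = 1 then 1 else 0 := by
  simp [secondCount, List.ofFn_succ, List.count_cons]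

theorem secondCount_succ_last {n : ℕ} (c : Fin (n + 1) → Fin 3) :
    secondCount c = secondCount (fun i => c i.castSucc) + if c (Fin.last n) = 1 then 1 else 0 := by
  rw [secondCount, List.ofFn_succ', List.concat_eq_append, List.count_append, List.count_singleton,
    secondCount]
  simp

theorem bondSwap_involutive {n : ℕ} (i : Fin n) : Function.Involutive (bondSwap i) := fun c => by
  funext j; simp [bondSwap]

theorem siteFlip_involutive {n : ℕ} (i : Fin n) : Function.Involutive (siteFlip i) := fun c => by
  simp [siteFlip]

theorem secondCount_bondSwap {n : ℕ} (i : Fin n) (c : Fin (n + 1) → Fin 3) :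
    secondCount (bondSwap i c) = secondCount c :=
  (Equiv.Perm.ofFn_comp_perm _ c).count_eq 1

theorem rev_eq_one_iff (a : Fin 3) : a.rev = 1 ↔ a = 1 := by
  revert a; decide

theorem siteFlip_zero_succ {n : ℕ} (c : Fin (n + 1) → Fin 3) (i : Fin n) :
    siteFlip 0 c i.succ = c i.succ := by
  simp [siteFlip]

theorem siteFlip_last_castSucc {n : ℕ} (c : Fin (n + 1) → Fin 3) (i : Fin n) :
    siteFlip (Fin.last n) c i.castSucc = c i.castSucc := by
  simp [siteFlip]

theorem siteFlip_self {n : ℕ} (i : Fin n) (c : Fin n → Fin 3) : siteFlip i c i = (c i).rev := by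
  simp [siteFlip]

theorem secondCount_siteFlip_zero {n : ℕ} (c : Fin (n + 1) → Fin 3) :
    secondCount (siteFlip 0 c) = secondCount c := by
  simp only [secondCount_succ, siteFlip_zero_succ, siteFlip_self, rev_eq_one_iff]

theorem secondCount_siteFlip_last {n : ℕ} (c : Fin (n + 1) → Fin 3) :
    secondCount (siteFlip (Fin.last n) c) = secondCount c := by
  simp only [secondCount_succ_last, siteFlip_last_castSucc, siteFlip_self, rev_eq_one_iff]

/-- Telescoping of the bulk generator on matrix products. -/
theorem sum_bondSwap_wordProd {R : Type*} [Ring R] [Algebra ℝ R] {q : ℝ} {X : Fin 3 → R}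
    {x : Fin 3 → ℝ}
    (hX : ∀ a b, swapRate q b a • (X b * X a) - swapRate q a b • (X a * X b)
      = x a • X b - x b • X a) {n : ℕ} (c : Fin (n + 1) → Fin 3) :
    ∑ i : Fin n, (swapRate q (c i.succ) (c i.castSucc) • wordProd X (bondSwap i c)
        - swapRate q (c i.castSucc) (c i.succ) • wordProd X c)
      = x (c 0) • wordProd X (fun i => c i.succ)
        - x (c (Fin.last n)) • wordProd X fun i => c i.castSucc := by
  induction n with
  | zero => simp [wordProd]
  | succ n ih =>
    have hsucc : ∀ i : Fin n, (fun j : Fin (n + 1) => bondSwap i.succ c j.succ)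
        = bondSwap i fun j => c j.succ := by
      intro i
      funext j
      simp only [bondSwap, Function.comp, ← Fin.succ_castSucc]
      rw [← (Fin.succ_injective _).map_swap]
    have hzero : ∀ i : Fin n, bondSwap i.succ c 0 = c 0 := by
      intro i
      simp only [bondSwap, Function.comp]
      rw [Equiv.swap_apply_of_ne_of_ne]
      · rw [← Fin.succ_castSucc]; exact (Fin.succ_ne_zero _).symm
      · exact (Fin.succ_ne_zero _).symm
    have h00 : bondSwap (0 : Fin (n + 1)) c 0 = c 1 := by simp [bondSwap]
    have h01 : bondSwap (0 : Fin (n + 1)) c (Fin.succ 0) = c 0 := by simp [bondSwap]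
    have h0s : ∀ i : Fin n, bondSwap (0 : Fin (n + 1)) c i.succ.succ = c i.succ.succ := by
      intro i
      simp only [bondSwap, Function.comp]
      rw [Equiv.swap_apply_of_ne_of_ne]
      · exact Fin.succ_ne_zero _
      · exact fun h => Fin.succ_ne_zero _ (Fin.succ_injective _ h)
    have key := congrArg (X (c 0) * ·) (ih fun j => c j.succ)
    simp only [Finset.mul_sum, mul_sub, mul_smul_comm] at key
    rw [Fin.sum_univ_succ]
    have hrest : ∀ i : Fin n,
        swapRate q (c i.succ.succ) (c i.succ.castSucc) • wordProd X (bondSwap i.succ c)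
          - swapRate q (c i.succ.castSucc) (c i.succ.succ) • wordProd X c
        = swapRate q (c i.succ.succ) (c i.castSucc.succ)
            • (X (c 0) * wordProd X (bondSwap i fun j => c j.succ))
          - swapRate q (c i.castSucc.succ) (c i.succ.succ)
            • (X (c 0) * wordProd X fun j => c j.succ) := by
      intro i
      rw [wordProd_succ X (bondSwap i.succ c), wordProd_succ X c, hsucc, hzero, Fin.succ_castSucc]
    rw [Finset.sum_congr rfl fun i _ => hrest i, key]
    have hloc := congrArg (· * wordProd X fun i : Fin n => c i.succ.succ) (hX (c 0) (c 1))
    simp only [sub_mul, smul_mul_assoc, mul_assoc] at hloc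
    have e1 : wordProd X (bondSwap (0 : Fin (n + 1)) c)
        = X (c 1) * (X (c 0) * wordProd X fun i : Fin n => c i.succ.succ) := by
      rw [wordProd_succ, wordProd_succ]
      simp only [h00, h01, h0s]
    have e2 : (wordProd X fun i : Fin (n + 1) => c i.succ)
        = X (c 1) * wordProd X fun i : Fin n => c i.succ.succ := wordProd_succ _ _
    have e3 : (wordProd X fun i : Fin (n + 1) => c i.castSucc)
        = X (c 0) * wordProd X fun i : Fin n => c i.castSucc.succ := wordProd_succ _ _
    rw [e1, wordProd_succ X c, e2, e3]
    simp only [Fin.castSucc_zero, Fin.succ_zero_eq_one, Fin.succ_last] at hloc ⊢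
    rw [hloc]
    abel

theorem sum_fin_succ_config {M : Type*} [AddCommMonoid M] {n : ℕ}
    (f : (Fin (n + 1) → Fin 3) → M) :
    ∑ c, f c = ∑ a, ∑ c : Fin n → Fin 3, f (Fin.cons a c) := by
  rw [← Fintype.sum_prod_type' fun a c => f (Fin.cons a c)]
  exact ((Fin.consEquiv fun _ : Fin (n + 1) => Fin 3).sum_comp f).symm

theorem sum_wordProd_secondCount_zero {R : Type*} [Ring R] (X : Fin 3 → R) (n : ℕ) :
    ∑ c : Fin n → Fin 3, (if secondCount c = 0 then wordProd X c else 0) = (X 2 + X 0) ^ n := by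
  induction n with
  | zero => simp [secondCount, wordProd]
  | succ n ih =>
    rw [sum_fin_succ_config, Fin.sum_univ_three, pow_succ', ← ih]
    simp only [secondCount_succ, wordProd_succ, Fin.cons_zero, Fin.cons_succ, add_mul,
      Finset.mul_sum, mul_ite, mul_zero]
    simp only [← Finset.sum_add_distrib]
    refine Finset.sum_congr rfl fun c _ => ?_
    by_cases h : secondCount c = 0 <;> simp [h, add_comm]

theorem sum_wordProd_secondCount_one {R : Type*} [Ring R] (X : Fin 3 → R) (n : ℕ) :
    ∑ c : Fin n → Fin 3, (if secondCount c = 1 then wordProd X c else 0)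
      = ∑ i ∈ Finset.range n, (X 2 + X 0) ^ i * (X 1 * (X 2 + X 0) ^ (n - 1 - i)) := by
  induction n with
  | zero => simp [secondCount]
  | succ n ih =>
    have hshift : ∀ i, (X 2 + X 0) ^ (i + 1) * (X 1 * (X 2 + X 0) ^ (n + 1 - 1 - (i + 1)))
        = (X 2 + X 0) * ((X 2 + X 0) ^ i * (X 1 * (X 2 + X 0) ^ (n - 1 - i))) := by
      intro i
      rw [pow_succ', mul_assoc, show n + 1 - 1 - (i + 1) = n - 1 - i by omega]
    rw [sum_fin_succ_config, Fin.sum_univ_three, Finset.sum_range_succ',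
      Finset.sum_congr rfl fun i _ => hshift i, ← Finset.mul_sum, ← ih]
    simp only [pow_zero, one_mul, Nat.add_sub_cancel, Nat.sub_zero]
    rw [← sum_wordProd_secondCount_zero X n]
    simp only [secondCount_succ, wordProd_succ, Fin.cons_zero, Fin.cons_succ, add_mul,
      Finset.mul_sum, mul_ite, mul_zero]
    simp only [← Finset.sum_add_distrib]
    refine Finset.sum_congr rfl fun c _ => ?_
    by_cases h : secondCount c = 0 <;> by_cases h' : secondCount c = 1 <;> simp [h, h'] <;> abel

/-- Every configuration with one second class particle, except the one with this particle at the
right end and holes elsewhere, can be lowered by an exchange of a descent or by ejecting a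
particle at the right end. -/
theorem exists_descent_or_last {n : ℕ} {c : Fin (n + 1) → Fin 3} (h1 : secondCount c = 1)
    (hc : c ≠ Fin.snoc (α := fun _ => Fin 3) (fun _ => 0) 1) :
    (∃ i : Fin n, c i.succ < c i.castSucc) ∨ c (Fin.last n) = 2 := by
  by_contra! h
  obtain ⟨hmono, hlast⟩ := h
  have hmon : Monotone c := Fin.monotone_iff_le_succ.2 hmono
  have hle : ∀ i, c i ≤ c (Fin.last n) := fun i => hmon (Fin.le_last i)
  have hmem : (1 : Fin 3) ∈ List.ofFn c := List.count_pos_iff.1 (by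
    rw [secondCount] at h1; omega)
  obtain ⟨j, hj⟩ := (List.mem_ofFn' _ _).1 hmem
  have hl1 : c (Fin.last n) = 1 := by
    have := hle j
    rw [hj] at this
    omega
  rw [secondCount_succ_last, hl1, if_pos rfl, Nat.add_eq_right, secondCount,
    List.count_eq_zero] at h1
  refine hc (funext fun i => ?_)
  refine Fin.lastCases ?_ (fun i => ?_) i
  · simp [hl1]
  · have h2 : c i.castSucc ≠ 1 := fun h => h1 ((List.mem_ofFn' _ _).2 ⟨i, h⟩)
    have h3 := hle i.castSucc
    rw [hl1] at h3
    rw [Fin.snoc_castSucc]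
    omega

section DEHP

variable {V : Type*} [AddCommGroup V] [Module ℝ V] {q α β γ δ : ℝ}
  {Dm Em : Module.End ℝ V} {w : V →ₗ[ℝ] ℝ} {v : V}

/-- The weights of the configurations with one second class particle are all zero as soon as their
sum is. -/
theorem weight_eq_zero_of_sum_eq_zero (hα : 0 < α) (hβ : 0 < β) (hγ : 0 ≤ γ) (hδ : 0 ≤ δ)
    (hq0 : 0 ≤ q) {X : Fin 3 → Module.End ℝ V}
    (hX : ∀ a b, swapRate q b a • (X b * X a) - swapRate q a b • (X a * X b)
      = (![1, 0, -1] : Fin 3 → ℝ) a • X b - (![1, 0, -1] : Fin 3 → ℝ) b • X a)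
    (hw : ∀ u, α * w (X 0 u) - γ * w (X 2 u) = w u)
    (hv : β • X 2 v - δ • X 0 v = v) {n : ℕ}
    (hsum : ∑ c : Fin (n + 1) → Fin 3, (if secondCount c = 1 then w (wordProd X c v) else 0) = 0)
    {c : Fin (n + 1) → Fin 3} (hc : secondCount c = 1) : w (wordProd X c v) = 0 := by
  set F : (Fin (n + 1) → Fin 3) → ℝ :=
    fun c => if secondCount c = 1 then w (wordProd X c v) else 0 with hFdef
  let lRate : Fin 3 → ℝ := ![α, 0, γ]
  let rRate : Fin 3 → ℝ := ![δ, 0, β]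
  let σ : Fin n ⊕ Bool → (Fin (n + 1) → Fin 3) → Fin (n + 1) → Fin 3 :=
    Sum.elim bondSwap fun b => siteFlip (bif b then Fin.last n else 0)
  let r : Fin n ⊕ Bool → (Fin (n + 1) → Fin 3) → ℝ :=
    Sum.elim (fun i c => swapRate q (c i.castSucc) (c i.succ))
      fun b c => bif b then rRate (c (Fin.last n)) else lRate (c 0)
  have hleft : ∀ a u, lRate a.rev * w (X a.rev u) - lRate a * w (X a u)
      = -((![1, 0, -1] : Fin 3 → ℝ) a * w u) := by
    intro a u
    fin_cases a
    · simpa [lRate, show Fin.rev (0 : Fin 3) = 2 from rfl] using by linarith [hw u]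
    · simp [lRate, show Fin.rev (1 : Fin 3) = 1 from rfl]
    · simpa [lRate, show Fin.rev (2 : Fin 3) = 0 from rfl] using hw u
  have hright : ∀ a, rRate a.rev • X a.rev v - rRate a • X a v
      = (![1, 0, -1] : Fin 3 → ℝ) a • v := by
    intro a
    fin_cases a
    · simpa [rRate, show Fin.rev (0 : Fin 3) = 2 from rfl] using hv
    · simp [rRate, show Fin.rev (1 : Fin 3) = 1 from rfl]
    · simpa [rRate, show Fin.rev (2 : Fin 3) = 0 from rfl] using by
        rw [← neg_sub, hv]
  have hstat : ∀ c, ∑ m, (r m (σ m c) * F (σ m c) - r m c * F c) = 0 := by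
    intro c
    by_cases h1 : secondCount c = 1
    · simp only [Fintype.sum_sum_type, Fintype.sum_bool, r, σ, Sum.elim_inl, Sum.elim_inr,
        cond_true, cond_false, hFdef, secondCount_bondSwap, secondCount_siteFlip_zero,
        secondCount_siteFlip_last, h1, if_true, siteFlip_self]
      have hb := congrArg (fun T : Module.End ℝ V => w (T v)) (sum_bondSwap_wordProd hX c)
      simp only [LinearMap.sum_apply, map_sum, LinearMap.sub_apply, LinearMap.smul_apply, map_sub,
        map_smul, smul_eq_mul] at hb
      have hbs : ∀ i : Fin n, swapRate q (bondSwap i c i.castSucc) (bondSwap i c i.succ)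
          = swapRate q (c i.succ) (c i.castSucc) := by
        intro i; simp [bondSwap]
      simp only [hbs]
      rw [hb]
      have hl := hleft (c 0) ((wordProd X fun i => c i.succ) v)
      have hr := congrArg (fun u => w ((wordProd X fun i => c i.castSucc) u))
        (hright (c (Fin.last n)))
      simp only [map_sub, map_smul, smul_eq_mul] at hr
      have el : wordProd X (siteFlip 0 c) = X (c 0).rev * wordProd X fun i => c i.succ := by
        rw [wordProd_succ]; simp only [siteFlip_zero_succ, siteFlip_self]
      have er : wordProd X (siteFlip (Fin.last n) c)
          = (wordProd X fun i => c i.castSucc) * X (c (Fin.last n)).rev := by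
        rw [wordProd_succ_last]; simp only [siteFlip_last_castSucc, siteFlip_self]
      have el' : w (wordProd X c v) = w (X (c 0) ((wordProd X fun i => c i.succ) v)) := by
        rw [wordProd_succ]; rfl
      have er' : w (wordProd X c v)
          = w ((wordProd X fun i => c i.castSucc) (X (c (Fin.last n)) v)) := by
        rw [wordProd_succ_last]; rfl
      rw [el, er]
      simp only [Module.End.mul_apply]
      rw [← el'] at hl
      rw [← er'] at hr
      linarith
    · refine Finset.sum_eq_zero fun m _ => ?_
      have : secondCount (σ m c) ≠ 1 := by
        rcases m with i | b
        · simpa [σ, secondCount_bondSwap] using h1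
        · cases b
          · simpa [σ, secondCount_siteFlip_zero] using h1
          · simpa [σ, secondCount_siteFlip_last] using h1
      simp [hFdef, h1, this]
  have hrnn : ∀ m c, 0 ≤ r m c := by
    have hl : ∀ a, 0 ≤ lRate a := by intro a; fin_cases a <;> simp [lRate, hα.le, hγ]
    have hr : ∀ a, 0 ≤ rRate a := by intro a; fin_cases a <;> simp [rRate, hβ.le, hδ]
    rintro (i | b) c
    · simp only [r, Sum.elim_inl, swapRate]
      split_ifs <;> simp [hq0]
    · cases b
      · exact hl _
      · exact hr _
  have hσ : ∀ m, Function.Involutive (σ m) := by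
    rintro (i | b)
    · exact bondSwap_involutive i
    · exact siteFlip_involutive _
  have hF0 := stationary_eq_zero_of_sum_eq_zero σ hσ r hrnn (fun c => toLex c)
    (Fin.snoc (α := fun _ => Fin 3) (fun _ => 0) 1) F ?_ hstat hsum c
  · simpa [hFdef, hc] using hF0
  · intro c hFc hct
    have h1 : secondCount c = 1 := by
      by_contra h
      exact hFc (if_neg h)
    rcases exists_descent_or_last h1 hct with ⟨i, hi⟩ | hl
    · refine ⟨Sum.inl i, by simp [r, swapRate, hi], i.castSucc, fun j hj => ?_, ?_⟩
      · have : j ≠ i.castSucc := hj.ne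
        have : j ≠ i.succ := (hj.trans Fin.castSucc_lt_succ).ne
        simp [σ, bondSwap, Equiv.swap_apply_of_ne_of_ne, *]
      · simpa [σ, bondSwap] using hi
    · refine ⟨Sum.inr true, by simp [r, rRate, hl, hβ], Fin.last n, fun j hj => ?_, ?_⟩
      · have : j ≠ Fin.last n := hj.ne
        simp [σ, siteFlip, *]
      · simp [σ, siteFlip, hl, show Fin.rev (2 : Fin 3) = 0 from rfl]

theorem boundary_relation_of_weight_eq_zero
    (hDE : Dm * Em - q • (Em * Dm) = Dm + Em)
    (hw : ∀ u, α * w (Em u) - γ * w (Dm u) = w u)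
    (hv : β • Dm v - δ • Em v = v) (hwv : w v = 1)
    (hA : w ((Dm * Em - Em * Dm) v) = 0) :
    (α + β + γ + δ) * (α * β - γ * δ) = (1 - q) * ((α + δ) * (β + γ)) := by
  have h1 := hw v
  have h2 := congrArg w hv
  have h3 := congrArg (fun T : Module.End ℝ V => w (T v)) hDE
  have h4 := hw (Em v)
  have h5 := congrArg (fun u => w (Em u)) hv
  simp only [map_sub, map_smul, smul_eq_mul, LinearMap.sub_apply, LinearMap.smul_apply, map_add,
    LinearMap.add_apply, Module.End.mul_apply, hwv] at h1 h2 h3 h4 h5 hA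
  set x := w (Dm v)
  set y := w (Em v)
  set u := w (Em (Dm v))
  have hx : (α * β - γ * δ) * x = α + δ := by linear_combination δ * h1 + α * h2
  have hy : (α * β - γ * δ) * y = β + γ := by linear_combination β * h1 + γ * h2
  have hu : (1 - q) * u = x + y := by linear_combination h3 - hA
  have hmain : (α * β - γ * δ * q) * u = (α + δ) * y + γ * δ * (x + y) := by
    linear_combination γ * δ * h3 + δ * h4 + α * h5
  have hfin : (α * β - γ * δ) * (x + y) = (1 - q) * ((α + δ) * y) := by
    linear_combination (1 - q) * hmain - (α * β - γ * δ * q) * hu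
  linear_combination (α * β - γ * δ) * hfin - (α * β - γ * δ) * (hx + hy)
    + (1 - q) * (α + δ) * hy

end DEHP

/-- Assume `ABCD ∉ {q^{−l} : l ∈ ℕ₀}` and `AC ≠ 1`. For any DEHP
representation `(V, 𝐃, 𝐄, w, v)` with `w(v) = 1`, setting `𝐀 := 𝐃𝐄 − 𝐄𝐃`, the quantity
`Ẑ_N = Σ_{i=1}^N w((𝐃+𝐄)^{i−1} 𝐀 (𝐃+𝐄)^{N−i} v)` is nonzero for every `N ≥ 1`. -/
theorem stmt_9
    (q α β γ δ : ℝ) (hα : 0 < α) (hβ : 0 < β) (hγ : 0 ≤ γ) (hδ : 0 ≤ δ)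
    (hq0 : 0 ≤ q) (hq1 : q < 1)
    (A B C D : ℝ)
    (hA : A = phiP q β δ) (hB : B = phiM q β δ)
    (hC : C = phiP q α γ) (hD : D = phiM q α γ)
    (hABCD : ∀ l : ℕ, A * B * C * D ≠ q ^ (-(l : ℤ)))
    (hAC : A * C ≠ 1)
    (V : Type*) [AddCommGroup V] [Module ℝ V]
    (Dm Em : V →ₗ[ℝ] V) (w : V →ₗ[ℝ] ℝ) (v : V)
    (hDE : Dm ∘ₗ Em - q • (Em ∘ₗ Dm) = Dm + Em)
    (hw : w ∘ₗ (α • Em - γ • Dm) = w)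
    (hv : (β • Dm - δ • Em) v = v)
    (hwv : w v = 1)
    (N : ℕ) (hN : 1 ≤ N) :
    (∑ i ∈ Finset.range N,
        w (((Dm + Em) ^ i) ((Dm ∘ₗ Em - Em ∘ₗ Dm) (((Dm + Em) ^ (N - 1 - i)) v)))) ≠ 0 := by
  intro hzero
  replace hDE : (Dm * Em - q • (Em * Dm) : Module.End ℝ V) = Dm + Em := hDE
  replace hw : ∀ u, α * w (Em u) - γ * w (Dm u) = w u := fun u => by
    simpa using LinearMap.congr_fun hw u
  replace hv : β • Dm v - δ • Em v = v := by simpa using hv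
  obtain ⟨n, rfl⟩ : ∃ n, N = n + 1 := ⟨N - 1, by omega⟩
  let X : Fin 3 → Module.End ℝ V := ![Em, Dm * Em - Em * Dm, Dm]
  have hDE' : (Dm * Em : Module.End ℝ V) = q • (Em * Dm) + (Dm + Em) := by
    rw [← hDE]; abel
  have hDA : (Dm * (Dm * Em - Em * Dm) - q • ((Dm * Em - Em * Dm) * Dm) : Module.End ℝ V)
      = Dm * Em - Em * Dm := by
    have h1 : (Dm * (Em * Dm) : Module.End ℝ V) = q • (Em * Dm * Dm) + (Dm * Dm + Em * Dm) := by
      rw [← mul_assoc, hDE', add_mul, add_mul, smul_mul_assoc]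
    simp only [hDE', mul_sub, sub_mul, mul_add, add_mul, mul_smul_comm, smul_mul_assoc, h1]
    module
  have hAE : ((Dm * Em - Em * Dm) * Em - q • (Em * (Dm * Em - Em * Dm)) : Module.End ℝ V)
      = Dm * Em - Em * Dm := by
    have h1 : (Em * Dm * Em : Module.End ℝ V) = q • (Em * (Em * Dm)) + (Em * Dm + Em * Em) := by
      rw [mul_assoc, hDE', mul_add, mul_add, mul_smul_comm]
    simp only [hDE', mul_sub, sub_mul, mul_add, add_mul, mul_smul_comm, smul_mul_assoc, h1]
    module
  have hX : ∀ a b, swapRate q b a • (X b * X a) - swapRate q a b • (X a * X b)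
      = (![1, 0, -1] : Fin 3 → ℝ) a • X b - (![1, 0, -1] : Fin 3 → ℝ) b • X a := by
    intro a b
    fin_cases a <;> fin_cases b <;> simp [swapRate, X, hDE, hDA, hAE]
    · rw [← neg_sub, hAE]; abel
    · rw [← neg_sub, hDE]; abel
    · rw [← neg_sub, hDA]; abel
  have hsum : ∑ c : Fin (n + 1) → Fin 3,
      (if secondCount c = 1 then w (wordProd X c v) else 0) = 0 := by
    have h := congrArg (fun T : Module.End ℝ V => w (T v))
      (sum_wordProd_secondCount_one X (n + 1))
    simp only [LinearMap.sum_apply, map_sum] at h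
    refine Eq.trans (Finset.sum_congr rfl fun c _ => ?_) (h.trans hzero)
    split_ifs <;> simp
  have hweight := fun c => weight_eq_zero_of_sum_eq_zero hα hβ hγ hδ hq0 hX hw hv hsum (c := c)
  have hpow : ∀ m ≤ n, ∀ i j, i + j = m →
      w ((Dm ^ i * (Dm * Em - Em * Dm) * Dm ^ j : Module.End ℝ V) v) = 0 := by
    intro m hm
    induction hm using Nat.decreasingInduction with
    | self =>
      rintro i j hij
      let l : List (Fin 3) := List.replicate i 2 ++ 1 :: List.replicate j 2
      have hlen : l.length = n + 1 := by simp [l]; omega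
      have hofFn : List.ofFn (fun k : Fin (n + 1) => l.get (k.cast hlen.symm)) = l := by
        rw [← List.ofFn_congr hlen l.get, List.ofFn_get]
      have h := hweight (fun k => l.get (k.cast hlen.symm)) (by
        rw [secondCount, hofFn]; simp [l, List.count_replicate])
      rw [wordProd, show (fun k : Fin (n + 1) => X (l.get (k.cast hlen.symm)))
        = X ∘ fun k : Fin (n + 1) => l.get (k.cast hlen.symm) from rfl, ← List.map_ofFn,
        hofFn] at h
      simpa [l, X, mul_assoc] using h
    | of_succ m _ ih =>
      rintro i j rfl
      have e : (Dm ^ i * (Dm * Em - Em * Dm) * Dm ^ j : Module.End ℝ V)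
          = Dm ^ (i + 1) * (Dm * Em - Em * Dm) * Dm ^ j
            - q • (Dm ^ i * (Dm * Em - Em * Dm) * Dm ^ (j + 1)) := by
        conv_lhs => rw [← hDA]
        rw [pow_succ, pow_succ' _ j]
        simp only [mul_sub, sub_mul, mul_smul_comm, smul_mul_assoc, mul_assoc]
      rw [e, LinearMap.sub_apply, LinearMap.smul_apply, map_sub, map_smul,
        ih (i + 1) j (by omega), ih i (j + 1) (by omega)]
      simp
  have hA0 : w ((Dm * Em - Em * Dm : Module.End ℝ V) v) = 0 := by
    simpa using hpow 0 (Nat.zero_le n) 0 0 rfl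
  refine hAC ?_
  rw [hA, hC]
  exact phiP_mul_phiP_eq_one hα hβ hγ hδ
    (boundary_relation_of_weight_eq_zero hDE hw hv hwv hA0)

end
end

section
/- For each fixed q ∈ [0,1), the map (x,y) ↦ (φ_+(x,y), φ_−(x,y)) is a bijection from (0,∞) × [0,∞) onto [0,∞) × (−1,0]. Consequently, the assignment (α,β,γ,δ) ↦ (A,B,C,D) with A = φ_+(β,δ), B = φ_−(β,δ), C = φ_+(α,γ), D = φ_−(α,γ) is, for each fixed q ∈ [0,1), a bijection from {(α,β,γ,δ) : α,β > 0, γ,δ ≥ 0} onto {(A,B,C,D) : A,C ≥ 0, −1 < B ≤ 0, −1 < D ≤ 0}. -/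
open Classical

noncomputable section

theorem mul_phiP_add_phiM {q x y : ℝ} (hx : 0 < x) :
    x * (phiP q x y + phiM q x y) = 1 - q - x + y := by
  unfold phiP phiM
  field_simp
  ring

theorem mul_phiP_mul_phiM {q x y : ℝ} (hx : 0 < x) (hy : 0 ≤ y) :
    x * (phiP q x y * phiM q x y) = -y := by
  have hs := Real.sq_sqrt (show 0 ≤ (1 - q - x + y) ^ 2 + 4 * x * y by positivity)
  unfold phiP phiM
  generalize Real.sqrt ((1 - q - x + y) ^ 2 + 4 * x * y) = s at hs ⊢
  field_simp
  linear_combination -hs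

theorem mul_phiP_add_one_mul_phiM_add_one {q x y : ℝ} (hx : 0 < x) (hy : 0 ≤ y) :
    x * ((1 + phiP q x y) * (1 + phiM q x y)) = 1 - q := by
  linear_combination mul_phiP_add_phiM (q := q) (y := y) hx +
    mul_phiP_mul_phiM (q := q) hx hy

theorem abs_le_sqrt_discrim {q x y : ℝ} (hx : 0 < x) (hy : 0 ≤ y) :
    |1 - q - x + y| ≤ Real.sqrt ((1 - q - x + y) ^ 2 + 4 * x * y) :=
  Real.abs_le_sqrt (le_add_of_nonneg_right (by positivity))

theorem phiP_nonneg {q x y : ℝ} (hx : 0 < x) (hy : 0 ≤ y) : 0 ≤ phiP q x y :=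
  div_nonneg (by linarith [neg_le_of_abs_le (abs_le_sqrt_discrim (q := q) hx hy)])
    (by positivity)

theorem phiM_nonpos {q x y : ℝ} (hx : 0 < x) (hy : 0 ≤ y) : phiM q x y ≤ 0 :=
  div_nonpos_of_nonpos_of_nonneg
    (by linarith [le_of_abs_le (abs_le_sqrt_discrim (q := q) hx hy)]) (by positivity)

theorem neg_one_lt_phiM {q x y : ℝ} (hq : q < 1) (hx : 0 < x) (hy : 0 ≤ y) :
    -1 < phiM q x y := by
  have h := mul_phiP_add_one_mul_phiM_add_one (q := q) hx hy
  have hA := phiP_nonneg (q := q) hx hy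
  rw [← mul_assoc] at h
  have := pos_of_mul_pos_right (h ▸ sub_pos.2 hq) (by positivity)
  linarith

theorem phiP_eq_and_phiM_eq {q x y A B : ℝ} (hx : 0 < x) (hBA : B ≤ A)
    (hadd : x * (A + B) = 1 - q - x + y) (hmul : x * (A * B) = -y) :
    phiP q x y = A ∧ phiM q x y = B := by
  have hs : Real.sqrt ((1 - q - x + y) ^ 2 + 4 * x * y) = x * (A - B) := by
    rw [← Real.sqrt_sq (mul_nonneg hx.le (sub_nonneg.2 hBA)), ← hadd]
    congr 1
    linear_combination 4 * x * hmul
  unfold phiP phiM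
  rw [hs, ← hadd]
  constructor <;> field_simp <;> ring

/-- The first coordinate of the inverse of `(φ₊, φ₋)`. -/
def phiInvFst (q A B : ℝ) : ℝ := (1 - q) / ((1 + A) * (1 + B))

/-- The second coordinate of the inverse of `(φ₊, φ₋)`. -/
def phiInvSnd (q A B : ℝ) : ℝ := -(phiInvFst q A B * (A * B))

theorem phiInvFst_pos {q A B : ℝ} (hq : q < 1) (hA : 0 ≤ A) (hB : -1 < B) :
    0 < phiInvFst q A B :=
  div_pos (sub_pos.2 hq) (mul_pos (by linarith) (by linarith))

theorem phiInvSnd_nonneg {q A B : ℝ} (hq : q < 1) (hA : 0 ≤ A) (hB : -1 < B) (hB0 : B ≤ 0) :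
    0 ≤ phiInvSnd q A B :=
  neg_nonneg.2 (mul_nonpos_of_nonneg_of_nonpos (phiInvFst_pos hq hA hB).le
    (mul_nonpos_of_nonneg_of_nonpos hA hB0))

theorem phi_phiInv {q A B : ℝ} (hq : q < 1) (hA : 0 ≤ A) (hB : -1 < B) (hB0 : B ≤ 0) :
    phiP q (phiInvFst q A B) (phiInvSnd q A B) = A ∧
      phiM q (phiInvFst q A B) (phiInvSnd q A B) = B := by
  have h : phiInvFst q A B * ((1 + A) * (1 + B)) = 1 - q :=
    div_mul_cancel₀ _ (mul_pos (by linarith) (by linarith)).ne'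
  refine phiP_eq_and_phiM_eq (phiInvFst_pos hq hA hB) (hB0.trans hA) ?_ ?_ <;>
    unfold phiInvSnd
  · linear_combination h
  · ring

theorem phiInvFst_phi {q x y : ℝ} (hq : q < 1) (hx : 0 < x) (hy : 0 ≤ y) :
    phiInvFst q (phiP q x y) (phiM q x y) = x := by
  have hA := phiP_nonneg (q := q) hx hy
  have hB := neg_one_lt_phiM hq hx hy
  exact (eq_div_of_mul_eq (mul_pos (by linarith) (by linarith)).ne'
    (mul_phiP_add_one_mul_phiM_add_one hx hy)).symm

theorem phiInvSnd_phi {q x y : ℝ} (hq : q < 1) (hx : 0 < x) (hy : 0 ≤ y) :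
    phiInvSnd q (phiP q x y) (phiM q x y) = y := by
  rw [phiInvSnd, phiInvFst_phi hq hx hy, mul_phiP_mul_phiM hx hy, neg_neg]

/-- For each fixed `q ∈ [0,1)`, `(x,y) ↦ (φ₊(x,y), φ₋(x,y))` is a
bijection from `(0,∞) × [0,∞)` onto `[0,∞) × (−1,0]`; consequently
`(α,β,γ,δ) ↦ (A,B,C,D)` is a bijection from `{α,β > 0, γ,δ ≥ 0}` onto
`{A,C ≥ 0, −1 < B ≤ 0, −1 < D ≤ 0}`. -/
theorem stmt_17 (q : ℝ) (hq0 : 0 ≤ q) (hq1 : q < 1) :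
    Set.BijOn (fun p : ℝ × ℝ => (phiP q p.1 p.2, phiM q p.1 p.2))
      (Set.Ioi (0 : ℝ) ×ˢ Set.Ici (0 : ℝ))
      (Set.Ici (0 : ℝ) ×ˢ Set.Ioc (-1 : ℝ) 0) ∧
    Set.BijOn
      (fun p : ℝ × ℝ × ℝ × ℝ =>
        (phiP q p.2.1 p.2.2.2, phiM q p.2.1 p.2.2.2,
          phiP q p.1 p.2.2.1, phiM q p.1 p.2.2.1))
      {p : ℝ × ℝ × ℝ × ℝ | 0 < p.1 ∧ 0 < p.2.1 ∧ 0 ≤ p.2.2.1 ∧ 0 ≤ p.2.2.2}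
      {p : ℝ × ℝ × ℝ × ℝ | 0 ≤ p.1 ∧ (-1 < p.2.1 ∧ p.2.1 ≤ 0) ∧
        0 ≤ p.2.2.1 ∧ (-1 < p.2.2.2 ∧ p.2.2.2 ≤ 0)} := by
  constructor
  · refine Set.InvOn.bijOn
      (f' := fun p : ℝ × ℝ => (phiInvFst q p.1 p.2, phiInvSnd q p.1 p.2)) ⟨?_, ?_⟩ ?_ ?_
    · rintro ⟨x, y⟩ ⟨hx, hy⟩
      exact Prod.ext (phiInvFst_phi hq1 hx hy) (phiInvSnd_phi hq1 hx hy)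
    · rintro ⟨A, B⟩ ⟨hA, hB, hB0⟩
      have h := phi_phiInv hq1 hA hB hB0
      exact Prod.ext h.1 h.2
    · rintro ⟨x, y⟩ ⟨hx, hy⟩
      exact ⟨phiP_nonneg hx hy, neg_one_lt_phiM hq1 hx hy, phiM_nonpos hx hy⟩
    · rintro ⟨A, B⟩ ⟨hA, hB, hB0⟩
      exact ⟨phiInvFst_pos hq1 hA hB, phiInvSnd_nonneg hq1 hA hB hB0⟩
  · refine Set.InvOn.bijOn
      (f' := fun p : ℝ × ℝ × ℝ × ℝ =>
        (phiInvFst q p.2.2.1 p.2.2.2, phiInvFst q p.1 p.2.1,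
          phiInvSnd q p.2.2.1 p.2.2.2, phiInvSnd q p.1 p.2.1)) ⟨?_, ?_⟩ ?_ ?_
    · rintro ⟨α, β, γ, δ⟩ ⟨hα, hβ, hγ, hδ⟩
      exact Prod.ext (phiInvFst_phi hq1 hα hγ) (Prod.ext (phiInvFst_phi hq1 hβ hδ)
        (Prod.ext (phiInvSnd_phi hq1 hα hγ) (phiInvSnd_phi hq1 hβ hδ)))
    · rintro ⟨A, B, C, D⟩ ⟨hA, ⟨hB, hB0⟩, hC, hD, hD0⟩
      have h := phi_phiInv hq1 hA hB hB0
      have h' := phi_phiInv hq1 hC hD hD0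
      exact Prod.ext h.1 (Prod.ext h.2 (Prod.ext h'.1 h'.2))
    · rintro ⟨α, β, γ, δ⟩ ⟨hα, hβ, hγ, hδ⟩
      exact ⟨phiP_nonneg hβ hδ, ⟨neg_one_lt_phiM hq1 hβ hδ, phiM_nonpos hβ hδ⟩,
        phiP_nonneg hα hγ, neg_one_lt_phiM hq1 hα hγ, phiM_nonpos hα hγ⟩
    · rintro ⟨A, B, C, D⟩ ⟨hA, ⟨hB, hB0⟩, hC, hD, hD0⟩
      exact ⟨phiInvFst_pos hq1 hC hD, phiInvFst_pos hq1 hA hB,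
        phiInvSnd_nonneg hq1 hC hD hD0, phiInvSnd_nonneg hq1 hA hB hB0⟩

end
end

section
/- Let A, C ≥ 0 and B, D ∈ (−1, 0] be real numbers. Define (σ_ℓ, σ_r) as follows: if A ≥ 1 and A ≥ C, set σ_ℓ = (A² + A + 1 − ACD − AC − AD)/((A+1)²(1 − CD)) and σ_r = A/(1+A); otherwise, if C ≥ 1, set σ_ℓ = 1/(1+C) and σ_r = (AC + BC − ABC² − AB + C − ABC)/((C+1)²(1 − AB)); otherwise (so A < 1 and C < 1), set σ_ℓ = (3 − C − D − CD)/(4(1 − CD)) and σ_r = (1 + A + B − 3AB)/(4(1 − AB)). Then σ_ℓ = σ_r if and only if AC = 1. -/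
open Classical

noncomputable section

/-- Let `A, C ≥ 0` and `B, D ∈ (−1,0]`, and define `σℓ, σr` by the
phase-dependent formulas (high density if `A ≥ 1` and `A ≥ C`, low density if `C ≥ 1`
otherwise, maximal current otherwise). Then `σℓ = σr` if and only if `AC = 1`. -/
theorem stmt_18 (A B C D : ℝ) (hA : 0 ≤ A) (hC : 0 ≤ C)
    (hB1 : -1 < B) (hB0 : B ≤ 0) (hD1 : -1 < D) (hD0 : D ≤ 0)
    (σℓ σr : ℝ)
    (h : if 1 ≤ A ∧ C ≤ A then
          σℓ = (A ^ 2 + A + 1 - A * C * D - A * C - A * D) /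
              ((A + 1) ^ 2 * (1 - C * D)) ∧
          σr = A / (1 + A)
        else if 1 ≤ C then
          σℓ = 1 / (1 + C) ∧
          σr = (A * C + B * C - A * B * C ^ 2 - A * B + C - A * B * C) /
              ((C + 1) ^ 2 * (1 - A * B))
        else
          σℓ = (3 - C - D - C * D) / (4 * (1 - C * D)) ∧
          σr = (1 + A + B - 3 * A * B) / (4 * (1 - A * B))) :
    σℓ = σr ↔ A * C = 1 := by
  have hAB : A * B ≤ 0 := mul_nonpos_of_nonneg_of_nonpos hA hB0
  have hCD : C * D ≤ 0 := mul_nonpos_of_nonneg_of_nonpos hC hD0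
  have hAD : A * D ≤ 0 := mul_nonpos_of_nonneg_of_nonpos hA hD0
  have hCB : C * B ≤ 0 := mul_nonpos_of_nonneg_of_nonpos hC hB0
  have hAB' : 0 < 1 - A * B := by linarith
  have hCD' : 0 < 1 - C * D := by linarith
  split_ifs at h with h₁ h₂
  · obtain ⟨rfl, rfl⟩ := h
    rw [div_eq_div_iff (by positivity) (by positivity)]
    have hne : (1 + A) * (1 - A * D) ≠ 0 := mul_ne_zero (by positivity) (by linarith)
    constructor
    · intro e
      have : (1 + A) * (1 - A * D) * (1 - A * C) = 0 := by linear_combination e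
      linarith [(mul_eq_zero.mp this).resolve_left hne]
    · intro e
      linear_combination -(1 + A) * (1 - A * D) * e
  · obtain ⟨rfl, rfl⟩ := h
    rw [div_eq_div_iff (by positivity) (by positivity)]
    have hne : (1 + C) * (1 - C * B) ≠ 0 := mul_ne_zero (by positivity) (by linarith)
    constructor
    · intro e
      have : (1 + C) * (1 - C * B) * (1 - A * C) = 0 := by linear_combination e
      linarith [(mul_eq_zero.mp this).resolve_left hne]
    · intro e
      linear_combination -(1 + C) * (1 - C * B) * e
  · obtain ⟨rfl, rfl⟩ := h
    have hC1 : C < 1 := not_le.mp h₂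
    have hA1 : A < 1 := by
      by_contra! hA1
      exact h₁ ⟨hA1, by linarith⟩
    have hl : 1 / 2 < (3 - C - D - C * D) / (4 * (1 - C * D)) := by
      rw [div_lt_div_iff₀ (by norm_num) (by positivity)]
      nlinarith [mul_pos (sub_pos.mpr hC1) (by linarith : 0 < 1 - D)]
    have hr : (1 + A + B - 3 * A * B) / (4 * (1 - A * B)) < 1 / 2 := by
      rw [div_lt_div_iff₀ (by positivity) (by norm_num)]
      nlinarith [mul_pos (sub_pos.mpr hA1) (by linarith : 0 < 1 - B)]
    exact iff_of_false (hr.trans hl).ne' (by nlinarith)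

end
end
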